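/- arXiv:1310.5880 — 3 statements merged into one kernel-verified Lean document; each statement's English description precedes it below -/
import Mathlib

section
/- Let A₀, A₁, …, A_k ∈ ℂ^{n×n} be pairwise commuting normal matrices. Then the supremum over all unit vectors v ∈ ℂⁿ of the infimum over all coefficients α₁, …, α_k ∈ ℂ of ‖A₀v − Σ_{i=1}^k αᵢAᵢv‖ equals the infimum over all α₁, …, α_k ∈ ℂ of ‖A₀ − Σ_{i=1}^k αᵢAᵢ‖, where the vector norm is the Euclidean norm on ℂⁿ and the matrix norm is the operator norm induced by the Euclidean norm (spectral norm). -/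
open Matrix

/-- A family of operators that commute pairwise and with each other's adjoints is diagonalized by
a common orthonormal basis. -/
theorem exists_orthonormalBasis_forall_apply_eq_smul {ι E : Type*} [Finite ι]
    [NormedAddCommGroup E] [InnerProductSpace ℂ E] [FiniteDimensional ℂ E] {n : ℕ}
    (hn : Module.finrank ℂ E = n) (T : ι → E →L[ℂ] E)
    (hT : ∀ i, IsStarNormal (T i)) (hcomm : ∀ i j, Commute (T i) (T j)) :
    ∃ (b : OrthonormalBasis (Fin n) ℂ E) (c : ι → Fin n → ℂ),
      ∀ i m, T i (b m) = c i m • b m := by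
  classical
  have := Fintype.ofFinite ι
  have hstar (i j) : Commute (T i) (star (T j)) := (hT j).commute_star_right (hcomm i j)
  have hstar' (i j) : Commute (star (T i)) (T j) := (hstar j i).symm
  have hstar'' (i j) : Commute (star (T i)) (star (T j)) := (hcomm i j).star_star
  let S : ι × Bool → E →L[ℂ] E := fun p ↦
    if p.2 then T p.1 + star (T p.1) else Complex.I • (T p.1 - star (T p.1))
  have hS (p) : IsSelfAdjoint (S p) := by
    rcases p with ⟨i, _ | _⟩
    · simp [S, IsSelfAdjoint, smul_sub, neg_add_eq_sub]
    · simp [S, IsSelfAdjoint, add_comm]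
  have hScomm (p q) : Commute (S p) (S q) := by
    rcases p with ⟨i, _ | _⟩ <;> rcases q with ⟨j, _ | _⟩ <;> simp only [S, if_true, if_false,
      Bool.false_eq_true]
    · exact (((hcomm i j).sub_right (hstar i j)).sub_left
        ((hstar' i j).sub_right (hstar'' i j))).smul_left _ |>.smul_right _
    · exact (((hcomm i j).add_right (hstar i j)).sub_left
        ((hstar' i j).add_right (hstar'' i j))).smul_left _
    · exact (((hcomm i j).sub_right (hstar i j)).add_left
        ((hstar' i j).sub_right (hstar'' i j))).smul_right _
    · exact ((hcomm i j).add_right (hstar i j)).add_left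
        ((hstar' i j).add_right (hstar'' i j))
  have hsymm (p) : ((S p : E →L[ℂ] E) : E →ₗ[ℂ] E).IsSymmetric :=
    ContinuousLinearMap.isSelfAdjoint_iff_isSymmetric.mp (hS p)
  have hlin : Pairwise (Function.onFun Commute fun p ↦ (S p : E →ₗ[ℂ] E)) := fun p q _ ↦ by
    ext x
    exact DFunLike.congr_fun (hScomm p q).eq x
  let V : (ι × Bool → ℂ) → Submodule ℂ E :=
    fun χ ↦ ⨅ p, Module.End.eigenspace (S p : E →ₗ[ℂ] E) (χ p)
  have hV : DirectSum.IsInternal V :=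
    LinearMap.IsSymmetric.directSum_isInternal_of_pairwise_commute hsymm hlin
  have hVne := DirectSum.isInternal_ne_bot_iff.mpr hV
  have horth := (LinearMap.IsSymmetric.orthogonalFamily_iInf_eigenspaces hsymm).comp
    (Subtype.val_injective (p := fun χ ↦ V χ ≠ ⊥))
  let : Fintype {χ // V χ ≠ ⊥} :=
    hV.submodule_iSupIndep.fintypeNeBotOfFiniteDimensional
  let χ : Fin n → ι × Bool → ℂ := fun m ↦ (hVne.subordinateOrthonormalBasisIndex hn m horth).1
  refine ⟨hVne.subordinateOrthonormalBasis hn horth,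
    fun i m ↦ 2⁻¹ * (χ m (i, true) - Complex.I * χ m (i, false)), fun i m ↦ ?_⟩
  have hmem := hVne.subordinateOrthonormalBasis_subordinate hn m horth
  set x := hVne.subordinateOrthonormalBasis hn horth m
  have heig (p) : S p x = χ m p • x :=
    Module.End.mem_eigenspace_iff.mp ((Submodule.mem_iInf _).mp hmem p)
  have hdecomp : T i = (2⁻¹ : ℂ) • (S (i, true) - Complex.I • S (i, false)) := by
    simp only [S, if_true, if_false, Bool.false_eq_true, smul_smul, Complex.I_mul_I]
    module
  rw [hdecomp]
  simp only [_root_.smul_apply, _root_.sub_apply, heig]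
  module

/-- The squared norm of the image of a vector under an operator that is diagonal in an
orthonormal basis. -/
theorem OrthonormalBasis.norm_sq_apply_of_diagonal {ι E : Type*} [Fintype ι]
    [NormedAddCommGroup E] [InnerProductSpace ℂ E] (b : OrthonormalBasis ι ℂ E)
    (T : E →L[ℂ] E) (c : ι → ℂ) (hT : ∀ m, T (b m) = c m • b m) (v : E) :
    ‖T v‖ ^ 2 = ∑ m, ‖b.repr v m‖ ^ 2 * ‖c m‖ ^ 2 := by
  have hrepr (m) : b.repr (T v) m = b.repr v m * c m := by
    classical
    conv_lhs => rw [← b.sum_repr v]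
    simp [hT, Pi.single_apply]
  rw [← b.repr.norm_map (T v), EuclideanSpace.norm_sq_eq]
  simp [hrepr, mul_pow]

/-- The norm of an operator that is diagonal in an orthonormal basis is bounded by the modulus of
one of the diagonal entries. -/
theorem OrthonormalBasis.exists_opNorm_le_of_diagonal {ι E : Type*} [Fintype ι] [Nonempty ι]
    [NormedAddCommGroup E] [InnerProductSpace ℂ E] (b : OrthonormalBasis ι ℂ E)
    (T : E →L[ℂ] E) (c : ι → ℂ) (hT : ∀ m, T (b m) = c m • b m) :
    ∃ m, ‖T‖ ≤ ‖c m‖ := by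
  obtain ⟨m, hm⟩ := Finite.exists_max fun m ↦ ‖c m‖
  refine ⟨m, T.opNorm_le_bound (norm_nonneg _) fun v ↦ ?_⟩
  refine le_of_sq_le_sq ?_ (by positivity)
  rw [b.norm_sq_apply_of_diagonal T c hT, mul_pow, ← b.repr.norm_map v,
    EuclideanSpace.norm_sq_eq, Finset.mul_sum]
  refine Finset.sum_le_sum fun j _ ↦ ?_
  rw [mul_comm]
  gcongr
  exact hm j

/-- A minimax principle for finitely many convex functions: if at every point one of them is at
least `t`, then so is one of their convex combinations at every point. -/
theorem exists_mem_stdSimplex_forall_le_sum {ι F : Type*} [Fintype ι] [Nonempty ι]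
    [NormedAddCommGroup F] [NormedSpace ℝ F] (g : ι → F → ℝ)
    (hconv : ∀ m, ConvexOn ℝ Set.univ (g m)) (hcont : ∀ m, Continuous (g m)) (t : ℝ)
    (ht : ∀ y, ∃ m, t ≤ g m y) :
    ∃ w ∈ stdSimplex ℝ ι, ∀ y, t ≤ ∑ m, w m * g m y := by
  classical
  by_contra! hlt
  have hcontw (y : F) : Continuous fun w : ι → ℝ ↦ ∑ m, w m * g m y := by fun_prop
  obtain ⟨s, hs⟩ := (isCompact_stdSimplex ℝ ι).elim_finite_subcover
    (fun y : F ↦ {w : ι → ℝ | ∑ m, w m * g m y < t})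
    (fun y ↦ isOpen_lt (hcontw y) continuous_const)
    (fun w hw ↦ by simpa using hlt w hw)
  obtain ⟨y, -, hy⟩ := Sion.exists_lt_iInf_of_lt_iInf_of_finite
    (X := stdSimplex ℝ ι) (Y := (Set.univ : Set F)) (f := fun w y ↦ -∑ m, w m * g m y)
    (t := -t) (s := (s : Set F))
    ⟨_, single_mem_stdSimplex ℝ (Classical.arbitrary ι)⟩ (isCompact_stdSimplex ℝ ι)
    (fun y _ ↦ (hcontw y).neg.lowerSemicontinuous.lowerSemicontinuousOn _)
    (fun y _ ↦ ConvexOn.quasiconvexOn ⟨convex_stdSimplex ℝ ι, fun u _ v _ a b _ _ _ ↦ by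
      simp [add_mul, Finset.sum_add_distrib, Finset.mul_sum, mul_assoc, add_comm]⟩)
    convex_univ
    (fun w _ ↦ by
      refine Continuous.upperSemicontinuous ?_ |>.upperSemicontinuousOn _
      fun_prop)
    (fun w hw ↦ by
      refine ConcaveOn.quasiconcaveOn (ConvexOn.neg ?_)
      refine ⟨convex_univ, fun x _ y _ a b ha hb hab ↦ ?_⟩
      simp only [smul_eq_mul, Finset.mul_sum, ← Finset.sum_add_distrib]
      refine Finset.sum_le_sum fun m _ ↦ ?_
      have := mul_le_mul_of_nonneg_left
        ((hconv m).2 (Set.mem_univ x) (Set.mem_univ y) ha hb hab) (hw.1 m)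
      simp only [smul_eq_mul] at this
      linarith)
    (convex_stdSimplex ℝ ι) s.finite_toSet (Set.subset_univ _)
    (fun w hw ↦ by simpa using hs hw)
  obtain ⟨m, hm⟩ := ht y
  have := hy _ (single_mem_stdSimplex ℝ m)
  simp [Pi.single_apply] at this
  linarith

/-- Operators in an affine family that is diagonal in a common orthonormal basis are bounded below
on a single unit vector by any common lower bound of their norms. -/
theorem OrthonormalBasis.exists_norm_eq_one_forall_le_norm_apply {ι κ E : Type*} [Fintype ι]
    [Nonempty ι] [Fintype κ] [NormedAddCommGroup E] [InnerProductSpace ℂ E]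
    (b : OrthonormalBasis ι ℂ E) (T₀ : E →L[ℂ] E) (T : κ → E →L[ℂ] E) (c₀ : ι → ℂ)
    (c : κ → ι → ℂ) (hT₀ : ∀ m, T₀ (b m) = c₀ m • b m) (hT : ∀ i m, T i (b m) = c i m • b m)
    {r : ℝ} (hr : 0 ≤ r) (hle : ∀ α : κ → ℂ, r ≤ ‖T₀ - ∑ i, α i • T i‖) :
    ∃ v : E, ‖v‖ = 1 ∧ ∀ α : κ → ℂ, r ≤ ‖(T₀ - ∑ i, α i • T i) v‖ := by
  have hdiag (α : κ → ℂ) (m) :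
      (T₀ - ∑ i, α i • T i) (b m) = (c₀ m - ∑ i, α i * c i m) • b m := by
    simp [hT₀, hT, sub_smul, Finset.sum_smul, mul_smul]
  obtain ⟨w, hw, hwle⟩ := exists_mem_stdSimplex_forall_le_sum
    (fun m (α : κ → ℂ) ↦ ‖c₀ m - ∑ i, α i * c i m‖ ^ 2)
    (fun m ↦ by
      refine ConvexOn.pow ⟨convex_univ, fun x _ y _ s t hs ht hst ↦ ?_⟩
        (fun _ _ ↦ norm_nonneg _) 2
      have hsplit : c₀ m - ∑ i, (s • x + t • y) i * c i m =
          s • (c₀ m - ∑ i, x i * c i m) + t • (c₀ m - ∑ i, y i * c i m) := by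
        have hc₀ : c₀ m = s • c₀ m + t • c₀ m := by rw [← add_smul, hst, one_smul]
        conv_lhs => rw [hc₀]
        simp only [Pi.add_apply, Pi.smul_apply, add_mul, Finset.sum_add_distrib, smul_mul_assoc,
          ← Finset.smul_sum]
        module
      rw [hsplit]
      refine (norm_add_le _ _).trans_eq ?_
      simp [abs_of_nonneg hs, abs_of_nonneg ht])
    (fun m ↦ by fun_prop) (r ^ 2)
    (fun α ↦ by
      obtain ⟨m, hm⟩ := b.exists_opNorm_le_of_diagonal _ _ (hdiag α)
      exact ⟨m, pow_le_pow_left₀ hr ((hle α).trans hm) 2⟩)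
  let v : E := b.repr.symm (WithLp.toLp 2 fun m ↦ ((√(w m) : ℝ) : ℂ))
  have hv (m) : ‖b.repr v m‖ ^ 2 = w m := by
    simp [v, Real.sq_sqrt (hw.1 m)]
  refine ⟨v, ?_, fun α ↦ le_of_sq_le_sq ?_ (norm_nonneg _)⟩
  · rw [← sq_eq_sq₀ (norm_nonneg _) zero_le_one, ← b.repr.norm_map v, EuclideanSpace.norm_sq_eq]
    simp [hv, hw.2]
  · rw [b.norm_sq_apply_of_diagonal _ _ (hdiag α)]
    simpa only [hv] using hwle α

/-- Max-min equals min-max for pairwise commuting normal complex matrices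
(Greenbaum–Gurvits formulation, complex case). -/
theorem maxmin_eq_minmax_commuting_normal_complex
    (n k : ℕ) (A : Fin (k + 1) → Matrix (Fin n) (Fin n) ℂ)
    (hnormal : ∀ i, (A i)ᴴ * A i = A i * (A i)ᴴ)
    (hcomm : ∀ i j, A i * A j = A j * A i) :
    (⨆ v : {v : EuclideanSpace ℂ (Fin n) // ‖v‖ = 1},
      ⨅ α : Fin k → ℂ,
        ‖Matrix.toEuclideanCLM (𝕜 := ℂ) (A 0) v.1
          - ∑ i : Fin k, α i • Matrix.toEuclideanCLM (𝕜 := ℂ) (A i.succ) v.1‖)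
    = ⨅ α : Fin k → ℂ,
        ‖Matrix.toEuclideanCLM (𝕜 := ℂ) (A 0 - ∑ i : Fin k, α i • A i.succ)‖ := by
  have hmap (α : Fin k → ℂ) :
      Matrix.toEuclideanCLM (𝕜 := ℂ) (A 0 - ∑ i : Fin k, α i • A i.succ) =
        Matrix.toEuclideanCLM (𝕜 := ℂ) (A 0)
          - ∑ i : Fin k, α i • Matrix.toEuclideanCLM (𝕜 := ℂ) (A i.succ) := by
    simp [map_sub, map_sum, map_smul]
  have happly (α : Fin k → ℂ) (v : EuclideanSpace ℂ (Fin n)) :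
      Matrix.toEuclideanCLM (𝕜 := ℂ) (A 0) v
          - ∑ i : Fin k, α i • Matrix.toEuclideanCLM (𝕜 := ℂ) (A i.succ) v =
        (Matrix.toEuclideanCLM (𝕜 := ℂ) (A 0)
          - ∑ i : Fin k, α i • Matrix.toEuclideanCLM (𝕜 := ℂ) (A i.succ)) v := by
    simp
  simp only [hmap, happly]
  set T : Fin (k + 1) → EuclideanSpace ℂ (Fin n) →L[ℂ] EuclideanSpace ℂ (Fin n) :=
    fun i ↦ Matrix.toEuclideanCLM (𝕜 := ℂ) (A i) with hTdef
  change (⨆ v : {v : EuclideanSpace ℂ (Fin n) // ‖v‖ = 1},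
      ⨅ α : Fin k → ℂ, ‖(T 0 - ∑ i : Fin k, α i • T i.succ) v.1‖) =
    ⨅ α : Fin k → ℂ, ‖T 0 - ∑ i : Fin k, α i • T i.succ‖
  rcases n.eq_zero_or_pos with rfl | hn
  · have : IsEmpty {v : EuclideanSpace ℂ (Fin 0) // ‖v‖ = 1} :=
      ⟨fun v ↦ by simpa [Subsingleton.elim v.1 0] using v.2⟩
    simp [Real.iSup_of_isEmpty, Subsingleton.elim (_ : EuclideanSpace ℂ (Fin 0) →L[ℂ] _) 0]
  have : NeZero n := ⟨hn.ne'⟩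
  have hbdd (v : EuclideanSpace ℂ (Fin n)) :
      BddBelow (Set.range fun α : Fin k → ℂ ↦ ‖(T 0 - ∑ i : Fin k, α i • T i.succ) v‖) :=
    ⟨0, by rintro _ ⟨α, rfl⟩; exact norm_nonneg _⟩
  have hbdd' : BddBelow (Set.range fun α : Fin k → ℂ ↦ ‖T 0 - ∑ i : Fin k, α i • T i.succ‖) :=
    ⟨0, by rintro _ ⟨α, rfl⟩; exact norm_nonneg _⟩
  have hle (v : {v : EuclideanSpace ℂ (Fin n) // ‖v‖ = 1}) :
      (⨅ α : Fin k → ℂ, ‖(T 0 - ∑ i : Fin k, α i • T i.succ) v.1‖) ≤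
        ⨅ α : Fin k → ℂ, ‖T 0 - ∑ i : Fin k, α i • T i.succ‖ :=
    ciInf_mono (hbdd v.1) fun α ↦ ContinuousLinearMap.unit_le_opNorm _ _ v.2.le
  obtain ⟨b, c, hc⟩ := exists_orthonormalBasis_forall_apply_eq_smul finrank_euclideanSpace_fin T
    (fun i ↦ ⟨by
      rw [Commute, SemiconjBy, hTdef, ← map_star, ← map_mul, ← map_mul, star_eq_conjTranspose,
        hnormal]⟩)
    (fun i j ↦ by rw [Commute, SemiconjBy, hTdef, ← map_mul, ← map_mul, hcomm])
  obtain ⟨v, hv, hvle⟩ := b.exists_norm_eq_one_forall_le_norm_apply (T 0) (fun i : Fin k ↦ T i.succ)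
    (c 0) (fun i ↦ c i.succ) (hc 0) (fun i ↦ hc i.succ)
    (Real.iInf_nonneg fun α ↦ norm_nonneg _) (fun α ↦ ciInf_le hbdd' α)
  have : Nonempty {v : EuclideanSpace ℂ (Fin n) // ‖v‖ = 1} := ⟨v, hv⟩
  refine le_antisymm (ciSup_le hle) ?_
  exact (le_ciInf hvle).trans (le_ciSup (f := fun v : {v : EuclideanSpace ℂ (Fin n) // ‖v‖ = 1} ↦
    ⨅ α : Fin k → ℂ, ‖(T 0 - ∑ i : Fin k, α i • T i.succ) v.1‖)
    ⟨_, by rintro _ ⟨u, rfl⟩; exact hle u⟩ ⟨v, hv⟩)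
end

section
/- Let A ∈ ℂ^{n×n} be a normal matrix and let k ≥ 1. Then the supremum over all unit vectors v ∈ ℂⁿ of the infimum of ‖p(A)v‖ over all polynomials p ∈ ℂ[X] of degree at most k with p(0) = 1 equals the infimum over all such polynomials p of ‖p(A)‖, where the vector norm is the Euclidean norm on ℂⁿ and the matrix norm is the spectral norm. (This is the case f(z) = 1, φᵢ(z) = zⁱ of the max-min/min-max equality, corresponding to the worst-case GMRES bound.) -/
open Matrix Polynomial

/-- A convex set in `ι → ℝ` that misses the open orthant `{x | ∀ i, x i < c}` is separated from it
by a probability vector. -/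
theorem Convex.exists_weights_le_sum {ι : Type*} [Fintype ι] [Nonempty ι] {K : Set (ι → ℝ)}
    (hK : Convex ℝ K) (hne : K.Nonempty) {c : ℝ} (hc : ∀ x ∈ K, ∃ i, c ≤ x i) :
    ∃ w : ι → ℝ, (∀ i, 0 ≤ w i) ∧ ∑ i, w i = 1 ∧ ∀ x ∈ K, c ≤ ∑ i, w i * x i := by
  classical
  set s : Set (ι → ℝ) := Set.univ.pi fun _ => Set.Iio c with hs
  have hs₁ : Convex ℝ s := convex_pi fun _ _ => convex_Iio c
  have hs₂ : IsOpen s := isOpen_set_pi Set.finite_univ fun _ _ => isOpen_Iio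
  have hdisj : Disjoint s K := by
    refine Set.disjoint_left.2 fun x hx hxK => ?_
    obtain ⟨i, hi⟩ := hc x hxK
    exact absurd (hx i trivial) (not_lt.2 hi)
  obtain ⟨f, u, hfs, hfK⟩ := geometric_hahn_banach_open hs₁ hs₂ hK hdisj
  set w : ι → ℝ := fun i => f (Pi.single i 1) with hw
  have hf : ∀ x, f x = ∑ i, w i * x i := fun x => by
    conv_lhs => rw [pi_eq_sum_univ' x]
    simp [hw, map_sum, mul_comm]
  have hw0 : ∀ i, 0 ≤ w i := fun i => by
    by_contra! hi
    set a : ι → ℝ := fun _ => c - 1 with ha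
    have has : a ∈ s := fun j _ => by simp [ha]
    set t : ℝ := (u - f a) / (-w i) with ht
    have ht0 : 0 ≤ t := div_nonneg (sub_nonneg.2 (hfs a has).le) (by linarith)
    have hmem : a - t • Pi.single i 1 ∈ s := fun j _ => by
      by_cases hj : j = i
      · subst hj
        simp [ha]
        linarith
      · simp [ha, hj]
    have h := hfs _ hmem
    have htw : t * w i = -(u - f a) := by
      rw [ht]
      field_simp [hi.ne]
    rw [map_sub, map_smul, smul_eq_mul] at h
    change f a - t * w i < u at h
    linarith
  have hconst : ∀ d < c, d * ∑ i, w i < u := fun d hd => by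
    have h := hfs (fun _ => d) fun _ _ => hd
    rwa [hf, ← Finset.sum_mul, mul_comm] at h
  have hW : 0 < ∑ i, w i := by
    refine lt_of_le_of_ne (Finset.sum_nonneg fun i _ => hw0 i) fun h0 => ?_
    obtain ⟨x, hx⟩ := hne
    have hz := (Finset.sum_eq_zero_iff_of_nonneg fun i _ => hw0 i).1 h0.symm
    have h1 := hfK x hx
    have h2 := hconst (c - 1) (by linarith)
    rw [hf, Finset.sum_eq_zero fun i hi => by rw [hz i hi, zero_mul]] at h1
    rw [← h0, mul_zero] at h2
    linarith
  have hcu : c * ∑ i, w i ≤ u := by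
    rw [← le_div_iff₀ hW]
    exact le_of_forall_lt fun d hd => (lt_div_iff₀ hW).2 (hconst d hd)
  refine ⟨fun i => w i / ∑ j, w j, fun i => div_nonneg (hw0 i) hW.le, ?_, fun x hx => ?_⟩
  · rw [← Finset.sum_div, div_self hW.ne']
  · simp_rw [div_mul_eq_mul_div]
    rw [← Finset.sum_div, le_div_iff₀ hW, ← hf]
    exact hcu.trans (hfK x hx)

/-- Two commuting symmetric operators on a finite-dimensional inner product space have an
orthonormal basis of joint eigenvectors. -/
theorem LinearMap.IsSymmetric.exists_orthonormalBasis_of_commute {𝕜 E : Type*} [RCLike 𝕜]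
    [NormedAddCommGroup E] [InnerProductSpace 𝕜 E] [FiniteDimensional 𝕜 E] {n : ℕ}
    (hn : Module.finrank 𝕜 E = n) {S T : E →ₗ[𝕜] E} (hS : S.IsSymmetric) (hT : T.IsSymmetric)
    (hST : Commute S T) :
    ∃ (b : OrthonormalBasis (Fin n) 𝕜 E) (α β : Fin n → 𝕜),
      ∀ i, S (b i) = α i • b i ∧ T (b i) = β i • b i := by
  classical
  set V : 𝕜 × 𝕜 → Submodule 𝕜 E :=
    fun i => Module.End.eigenspace S i.2 ⊓ Module.End.eigenspace T i.1 with hV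
  have hint : DirectSum.IsInternal V := hS.directSum_isInternal_of_commute hT hST
  have horth := orthogonalFamily_eigenspace_inf_eigenspace hS hT
  have hfin : Fintype {i // V i ≠ ⊥} :=
    hint.submodule_iSupIndep.fintypeNeBotOfFiniteDimensional
  have hint' := DirectSum.isInternal_ne_bot_iff.2 hint
  have horth' := horth.comp (Subtype.val_injective (p := fun i => V i ≠ ⊥))
  refine ⟨hint'.subordinateOrthonormalBasis hn horth',
    fun a => (hint'.subordinateOrthonormalBasisIndex hn a horth').1.2,
    fun a => (hint'.subordinateOrthonormalBasisIndex hn a horth').1.1, fun a => ?_⟩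
  have h := hint'.subordinateOrthonormalBasis_subordinate hn a horth'
  exact ⟨Module.End.mem_eigenspace_iff.1 h.1, Module.End.mem_eigenspace_iff.1 h.2⟩

/-- The spectral theorem for normal matrices: a normal complex matrix has an orthonormal basis of
eigenvectors. -/
theorem Matrix.exists_orthonormalBasis_eigenvectors_of_normal {n : ℕ}
    {A : Matrix (Fin n) (Fin n) ℂ} (hA : Aᴴ * A = A * Aᴴ) :
    ∃ (b : OrthonormalBasis (Fin n) ℂ (EuclideanSpace ℂ (Fin n))) (μ : Fin n → ℂ),
      ∀ i, toEuclideanCLM (𝕜 := ℂ) A (b i) = μ i • b i := by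
  set S : Matrix (Fin n) (Fin n) ℂ := A + Aᴴ with hS
  set T : Matrix (Fin n) (Fin n) ℂ := Complex.I • (A - Aᴴ) with hT
  have hSh : S.IsHermitian := by simp [IsHermitian, hS, add_comm]
  have hTh : T.IsHermitian := by
    simp [IsHermitian, hT]
    rw [← smul_neg, neg_sub]
  have hcomm : S * T = T * S := by
    simp only [hS, hT, mul_smul_comm, smul_mul_assoc]
    congr 1
    noncomm_ring
    rw [hA]
    abel
  have hcomm' : Commute (toEuclideanCLM (𝕜 := ℂ) S).toLinearMap
      (toEuclideanCLM (𝕜 := ℂ) T).toLinearMap := by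
    ext1 v
    have h := congrArg (fun M => toEuclideanCLM (𝕜 := ℂ) M v) hcomm
    simpa using h
  obtain ⟨b, α, β, h⟩ := LinearMap.IsSymmetric.exists_orthonormalBasis_of_commute
    (finrank_euclideanSpace_fin (𝕜 := ℂ) (n := n)) (isSymmetric_toEuclideanLin_iff.2 hSh)
    (isSymmetric_toEuclideanLin_iff.2 hTh) hcomm'
  refine ⟨b, fun i => (1 / 2 : ℂ) * (α i - Complex.I * β i), fun i => ?_⟩
  have hdec : A = (1 / 2 : ℂ) • (S - Complex.I • T) := by
    rw [hS, hT, smul_smul, Complex.I_mul_I]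
    module
  have h1 : toEuclideanCLM (𝕜 := ℂ) S (b i) = α i • b i := (h i).1
  have h2 : toEuclideanCLM (𝕜 := ℂ) T (b i) = β i • b i := (h i).2
  rw [hdec]
  simp only [map_smul, map_sub, _root_.smul_apply, _root_.sub_apply,
    h1, h2]
  module

section Diagonalized

variable {n : ℕ} {A : Matrix (Fin n) (Fin n) ℂ}
  {b : OrthonormalBasis (Fin n) ℂ (EuclideanSpace ℂ (Fin n))} {μ : Fin n → ℂ}

theorem Matrix.toEuclideanCLM_aeval_apply_eigenvector {v : EuclideanSpace ℂ (Fin n)} {c : ℂ}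
    (h : toEuclideanCLM (𝕜 := ℂ) A v = c • v) (p : ℂ[X]) :
    toEuclideanCLM (𝕜 := ℂ) (aeval A p) v = p.eval c • v := by
  induction p using Polynomial.induction_on' with
  | add p q hp hq => simp only [map_add, _root_.add_apply, hp, hq, eval_add, add_smul]
  | monomial m a =>
    have hpow : ∀ m : ℕ, (toEuclideanCLM (𝕜 := ℂ) (A ^ m)) v = c ^ m • v := fun m => by
      induction m with
      | zero => simp
      | succ m ih =>
        rw [pow_succ, map_mul, mul_apply_eq_comp, h, map_smul, ih, smul_smul,
          pow_succ']
    rw [aeval_monomial, ← Algebra.smul_def, map_smul, _root_.smul_apply, hpow,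
      eval_monomial, smul_smul]

theorem Matrix.norm_sq_toEuclideanCLM_aeval_apply
    (h : ∀ i, toEuclideanCLM (𝕜 := ℂ) A (b i) = μ i • b i) (p : ℂ[X])
    (v : EuclideanSpace ℂ (Fin n)) :
    ‖toEuclideanCLM (𝕜 := ℂ) (aeval A p) v‖ ^ 2
      = ∑ i, ‖b.repr v i‖ ^ 2 * ‖p.eval (μ i)‖ ^ 2 := by
  have hv : toEuclideanCLM (𝕜 := ℂ) (aeval A p) v
      = b.repr.symm (WithLp.toLp 2 fun i => b.repr v i * p.eval (μ i)) := by
    conv_lhs => rw [← b.sum_repr v]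
    rw [map_sum, ← b.sum_repr_symm]
    refine Finset.sum_congr rfl fun i _ => ?_
    rw [map_smul, toEuclideanCLM_aeval_apply_eigenvector (h i), smul_smul]
  rw [hv, LinearIsometryEquiv.norm_map, EuclideanSpace.norm_sq_eq]
  simp [mul_pow]

theorem Matrix.exists_norm_toEuclideanCLM_aeval_le [Nonempty (Fin n)]
    (h : ∀ i, toEuclideanCLM (𝕜 := ℂ) A (b i) = μ i • b i) (p : ℂ[X]) :
    ∃ i, ‖toEuclideanCLM (𝕜 := ℂ) (aeval A p)‖ ≤ ‖p.eval (μ i)‖ := by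
  obtain ⟨i, hi⟩ := Finite.exists_max fun i => ‖p.eval (μ i)‖
  refine ⟨i, ContinuousLinearMap.opNorm_le_bound _ (norm_nonneg _) fun v => ?_⟩
  refine le_of_sq_le_sq ?_ (by positivity)
  rw [norm_sq_toEuclideanCLM_aeval_apply h, mul_pow, ← b.repr.norm_map v,
    EuclideanSpace.norm_sq_eq, Finset.mul_sum]
  refine Finset.sum_le_sum fun j _ => ?_
  rw [mul_comm]
  have := hi j
  gcongr

end Diagonalized

/-- The coordinatewise upper closure of the squared moduli of the values at `μ` of the polynomials
admissible for GMRES is convex. -/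
theorem convex_setOf_exists_norm_sq_eval_le {ι : Type*} (k : ℕ) (μ : ι → ℂ) :
    Convex ℝ {x : ι → ℝ | ∃ p : ℂ[X], (p.natDegree ≤ k ∧ p.eval 0 = 1) ∧
      ∀ i, ‖p.eval (μ i)‖ ^ 2 ≤ x i} := by
  rintro x ⟨p, ⟨hp, hp0⟩, hpx⟩ y ⟨q, ⟨hq, hq0⟩, hqy⟩ s t hs ht hst
  refine ⟨C (s : ℂ) * p + C (t : ℂ) * q, ⟨?_, ?_⟩, fun i => ?_⟩
  · exact natDegree_add_le_of_degree_le ((natDegree_C_mul_le _ _).trans hp)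
      ((natDegree_C_mul_le _ _).trans hq)
  · simp only [eval_add, eval_mul, eval_C, hp0, hq0, mul_one]
    exact_mod_cast hst
  · have hconv : ConvexOn ℝ Set.univ fun z : ℂ => ‖z‖ ^ 2 :=
      convexOn_univ_norm.pow (fun _ _ => norm_nonneg _) 2
    have h := hconv.2 (Set.mem_univ (p.eval (μ i))) (Set.mem_univ (q.eval (μ i))) hs ht hst
    simp only [Complex.real_smul, smul_eq_mul] at h
    simp only [eval_add, eval_mul, eval_C, Pi.add_apply, Pi.smul_apply, smul_eq_mul]
    exact h.trans (add_le_add (mul_le_mul_of_nonneg_left (hpx i) hs)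
      (mul_le_mul_of_nonneg_left (hqy i) ht))

/-- The worst-case GMRES case of the max-min/min-max equality for a normal complex
matrix: `f(z) = 1`, `φᵢ(z) = zⁱ`, i.e., polynomials of degree at most `k` with
value `1` at the origin. -/
theorem maxmin_eq_minmax_gmres_normal_complex
    (n k : ℕ) (hk : 1 ≤ k)
    (A : Matrix (Fin n) (Fin n) ℂ) (hA : Aᴴ * A = A * Aᴴ) :
    (⨆ v : {v : EuclideanSpace ℂ (Fin n) // ‖v‖ = 1},
      ⨅ p : {p : Polynomial ℂ // p.natDegree ≤ k ∧ p.eval 0 = 1},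
        ‖Matrix.toEuclideanCLM (𝕜 := ℂ) (aeval A p.1) v.1‖)
    = ⨅ p : {p : Polynomial ℂ // p.natDegree ≤ k ∧ p.eval 0 = 1},
        ‖Matrix.toEuclideanCLM (𝕜 := ℂ) (aeval A p.1)‖ := by
  have hbdd : ∀ v : EuclideanSpace ℂ (Fin n), BddBelow (Set.range
      fun p : {p : Polynomial ℂ // p.natDegree ≤ k ∧ p.eval 0 = 1} =>
        ‖Matrix.toEuclideanCLM (𝕜 := ℂ) (aeval A p.1) v‖) := fun v =>
    ⟨0, by rintro _ ⟨p, rfl⟩; exact norm_nonneg _⟩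
  have hbdd' : BddBelow (Set.range
      fun p : {p : Polynomial ℂ // p.natDegree ≤ k ∧ p.eval 0 = 1} =>
        ‖Matrix.toEuclideanCLM (𝕜 := ℂ) (aeval A p.1)‖) :=
    ⟨0, by rintro _ ⟨p, rfl⟩; exact norm_nonneg _⟩
  have hone : (1 : ℂ[X]).natDegree ≤ k ∧ (1 : ℂ[X]).eval 0 = 1 := by simp
  have : Nonempty {p : Polynomial ℂ // p.natDegree ≤ k ∧ p.eval 0 = 1} := ⟨⟨1, hone⟩⟩
  have hle : ∀ v : {v : EuclideanSpace ℂ (Fin n) // ‖v‖ = 1},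
      (⨅ p : {p : Polynomial ℂ // p.natDegree ≤ k ∧ p.eval 0 = 1},
        ‖Matrix.toEuclideanCLM (𝕜 := ℂ) (aeval A p.1) v.1‖)
      ≤ ⨅ p : {p : Polynomial ℂ // p.natDegree ≤ k ∧ p.eval 0 = 1},
        ‖Matrix.toEuclideanCLM (𝕜 := ℂ) (aeval A p.1)‖ := fun v =>
    ciInf_mono (hbdd v.1) fun p => ContinuousLinearMap.unit_le_opNorm _ _ v.2.le
  set m := ⨅ p : {p : Polynomial ℂ // p.natDegree ≤ k ∧ p.eval 0 = 1},
        ‖Matrix.toEuclideanCLM (𝕜 := ℂ) (aeval A p.1)‖ with hm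
  have hm0 : 0 ≤ m := Real.iInf_nonneg fun _ => norm_nonneg _
  refine le_antisymm (Real.iSup_le hle hm0) ?_
  rcases isEmpty_or_nonempty (Fin n) with hn | hn
  · refine (ciInf_le hbdd' ⟨1, hone⟩).trans ?_
    rw [Subsingleton.elim (toEuclideanCLM (𝕜 := ℂ) _) 0, norm_zero]
    exact Real.iSup_nonneg fun _ => Real.iInf_nonneg fun _ => norm_nonneg _
  · obtain ⟨b, μ, hμ⟩ := exists_orthonormalBasis_eigenvectors_of_normal hA
    obtain ⟨w, hw0, hw1, hw⟩ := (convex_setOf_exists_norm_sq_eval_le k μ).exists_weights_le_sum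
      (c := m ^ 2) ⟨_, 1, hone, fun _ => le_rfl⟩ (by
        rintro x ⟨p, hp, hpx⟩
        obtain ⟨i, hi⟩ := exists_norm_toEuclideanCLM_aeval_le hμ p
        have hmp : m ≤ ‖p.eval (μ i)‖ := (ciInf_le hbdd' ⟨p, hp⟩).trans hi
        exact ⟨i, (pow_le_pow_left₀ hm0 hmp 2).trans (hpx i)⟩)
    set v := b.repr.symm (WithLp.toLp 2 fun i => ((√(w i) : ℝ) : ℂ)) with hv
    have hvi : ∀ i, ‖b.repr v i‖ ^ 2 = w i := fun i => by simp [hv, Real.sq_sqrt (hw0 i)]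
    have hv1 : ‖v‖ = 1 := by
      rw [← b.repr.norm_map, EuclideanSpace.norm_eq]
      simp [hvi, hw1]
    refine le_trans ?_ (le_ciSup ⟨m, by rintro _ ⟨v, rfl⟩; exact hle v⟩ ⟨v, hv1⟩)
    refine le_ciInf fun p => le_of_sq_le_sq ?_ (norm_nonneg _)
    simp_rw [norm_sq_toEuclideanCLM_aeval_apply hμ, hvi]
    exact hw _ ⟨p.1, p.2, fun _ => le_rfl⟩
end

section
/- Let A ∈ ℝ^{n×n} be a normal matrix (AᵀA = AAᵀ) and let k ≥ 1. Then the supremum over all unit vectors v ∈ ℝⁿ of the infimum of ‖p(A)v‖ over all polynomials p ∈ ℝ[X] of degree at most k with p(0) = 1 equals the infimum over all such polynomials p of ‖p(A)‖, where the vector norm is the Euclidean norm on ℝⁿ and the matrix norm is the spectral norm. -/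
open Matrix Polynomial

/-- A finite family of convex functions whose pointwise maximum is at least `m` on a convex set
has a convex combination that is at least `m` on this set. -/
theorem exists_mem_stdSimplex_forall_le_sum_s5 {ι F : Type*} [Fintype ι] [Nonempty ι]
    [AddCommGroup F] [Module ℝ F] {P : Set F} (hP : P.Nonempty) {g : ι → F → ℝ}
    (hg : ∀ i, ConvexOn ℝ P (g i)) {m : ℝ} (h : ∀ p ∈ P, ∃ i, m ≤ g i p) :
    ∃ w ∈ stdSimplex ℝ ι, ∀ p ∈ P, m ≤ ∑ i, w i * g i p := by
  classical
  obtain ⟨p₀, hp₀⟩ := hP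
  set s : Set (ι → ℝ) := Set.univ.pi fun _ => Set.Iio m with hs
  set t : Set (ι → ℝ) := {x | ∃ p ∈ P, ∀ i, g i p ≤ x i} with ht
  have hs_convex : Convex ℝ s := convex_pi fun _ _ => convex_Iio m
  have hs_open : IsOpen s := isOpen_set_pi Set.finite_univ fun _ _ => isOpen_Iio
  have ht_convex : Convex ℝ t := by
    rintro x ⟨p, hp, hpx⟩ y ⟨q, hq, hqy⟩ a b ha hb hab
    refine ⟨a • p + b • q, (hg (Classical.arbitrary ι)).1 hp hq ha hb hab, fun i => ?_⟩
    refine ((hg i).2 hp hq ha hb hab).trans ?_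
    simp only [smul_eq_mul, Pi.add_apply, Pi.smul_apply]
    gcongr
    · exact hpx i
    · exact hqy i
  have hst : Disjoint s t := by
    rw [Set.disjoint_left]
    rintro x hx ⟨p, hp, hpx⟩
    obtain ⟨i, hi⟩ := h p hp
    exact (hi.trans (hpx i)).not_gt (hx i trivial)
  obtain ⟨f, u, hfs, hft⟩ := geometric_hahn_banach_open hs_convex hs_open ht_convex hst
  set c : ι → ℝ := fun i => f (Pi.single i 1) with hc
  have hf : ∀ x : ι → ℝ, f x = ∑ i, c i * x i := fun x => by
    conv_lhs => rw [pi_eq_sum_univ' x, map_sum]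
    refine Finset.sum_congr rfl fun i _ => ?_
    rw [map_smul, smul_eq_mul, mul_comm, hc]
  have hc_nonneg : ∀ i, 0 ≤ c i := fun i => by
    by_contra! hci
    obtain ⟨r, hr⟩ := exists_gt (max 0 ((u - f fun j => g j p₀) / c i))
    have hr₀ : 0 < r := (le_max_left _ _).trans_lt hr
    have hmem : (fun j => g j p₀) + r • Pi.single i (1 : ℝ) ∈ t :=
      ⟨p₀, hp₀, fun j => by
        have : 0 ≤ Pi.single (M := fun _ => ℝ) i 1 j := by
          rw [Pi.single_apply]; split_ifs <;> norm_num
        simpa using mul_nonneg hr₀.le this⟩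
    have hu := hft _ hmem
    rw [map_add, map_smul, smul_eq_mul] at hu
    have := (div_lt_iff_of_neg hci).1 ((le_max_right _ _).trans_lt hr)
    change u ≤ _ + r * c i at hu
    linarith
  have hlt : ∀ r < m, r * ∑ i, c i < u := fun r hr => by
    have := hfs (fun _ => r) fun i _ => hr
    rwa [hf, ← Finset.sum_mul, mul_comm] at this
  have hP_le : ∀ p ∈ P, u ≤ ∑ i, c i * g i p := fun p hp => by
    simpa [hf] using hft (fun i => g i p) ⟨p, hp, fun _ => le_rfl⟩
  have hc_pos : 0 < ∑ i, c i := by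
    refine (Finset.sum_nonneg fun i _ => hc_nonneg i).lt_of_ne' fun h0 => ?_
    have hc0 : ∀ i, c i = 0 := fun i =>
      (Finset.sum_eq_zero_iff_of_nonneg fun i _ => hc_nonneg i).1 h0 i (Finset.mem_univ i)
    have h1 := hlt (m - 1) (by linarith)
    have h2 := hP_le p₀ hp₀
    simp [hc0] at h1 h2
    linarith
  have hm : m * ∑ i, c i ≤ u := by
    rw [← le_div_iff₀ hc_pos]
    exact le_of_forall_lt fun r hr => (lt_div_iff₀ hc_pos).2 (hlt r hr)
  refine ⟨fun i => c i / ∑ j, c j, ⟨fun i => div_nonneg (hc_nonneg i) hc_pos.le, ?_⟩,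
    fun p hp => ?_⟩
  · rw [← Finset.sum_div, div_self hc_pos.ne']
  · simp_rw [div_mul_eq_mul_div]
    rw [← Finset.sum_div, le_div_iff₀ hc_pos]
    exact hm.trans (hP_le p hp)

section InnerProductSpace

variable {E : Type*} [NormedAddCommGroup E] [InnerProductSpace ℝ E] [FiniteDimensional ℝ E]

open scoped RealInnerProductSpace

/-- If the operators `T i† * T i` commute, then the quadratic forms `‖T i v‖ ^ 2` are simultaneously
diagonal in some orthonormal basis. -/
theorem exists_orthonormalBasis_norm_apply_sq_eq_sum {ι : Type*} (T : ι → E →L[ℝ] E)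
    (hT : ∀ i j, Commute (star (T i) * T i) (star (T j) * T j)) :
    ∃ b : OrthonormalBasis (Fin (Module.finrank ℝ E)) ℝ E,
      ∀ i v, ‖T i v‖ ^ 2 = ∑ l, ⟪b l, v⟫ ^ 2 * ‖T i (b l)‖ ^ 2 := by
  classical
  set S : ι → Module.End ℝ E := fun i => ((star (T i) * T i : E →L[ℝ] E) : E →ₗ[ℝ] E) with hS
  have hS_inner : ∀ i v w, ⟪S i v, w⟫ = ⟪T i v, T i w⟫ := fun i v w => by
    simp [hS, ContinuousLinearMap.star_eq_adjoint, ContinuousLinearMap.adjoint_inner_left]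
  have hS_symm : ∀ i, (S i).IsSymmetric := fun i v w => by
    rw [hS_inner, real_inner_comm, ← hS_inner, real_inner_comm]
  have hS_comm : Pairwise (Function.onFun Commute S) := fun i j _ => by
    have := hT i j
    exact congrArg (fun f : E →L[ℝ] E => (f : E →ₗ[ℝ] E)) this
  have hort' := LinearMap.IsSymmetric.orthogonalFamily_iInf_eigenspaces hS_symm
  have hort := hort'.comp
    (Subtype.val_injective (p := fun χ => ⨅ i, Module.End.eigenspace (S i) (χ i) ≠ ⊥))
  have hint := DirectSum.isInternal_ne_bot_iff.2
    (LinearMap.IsSymmetric.directSum_isInternal_of_pairwise_commute hS_symm hS_comm)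
  have hfin := WellFoundedGT.finite_ne_bot_of_iSupIndep hort'.independent
  have : Fintype {χ : ι → ℝ // ⨅ i, Module.End.eigenspace (S i) (χ i) ≠ ⊥} :=
    @Fintype.ofFinite _ hfin.to_subtype
  obtain ⟨b, α, hb⟩ : ∃ (b : OrthonormalBasis (Fin (Module.finrank ℝ E)) ℝ E)
      (α : Fin (Module.finrank ℝ E) → ι → ℝ), ∀ l i, S i (b l) = α l i • b l := by
    let I := hint.sigmaOrthonormalBasisIndexEquiv rfl hort
    refine ⟨(hint.collectedOrthonormalBasis hort fun i => stdOrthonormalBasis ℝ _).reindex I,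
      fun l => (I.symm l).1.1, fun l i => ?_⟩
    rw [OrthonormalBasis.coe_reindex]
    have := hint.collectedOrthonormalBasis_mem hort (fun i => stdOrthonormalBasis ℝ _) (I.symm l)
    exact Module.End.mem_eigenspace_iff.1 ((Submodule.mem_iInf _).1 this i)
  refine ⟨b, fun i v => ?_⟩
  have hα : ∀ l, α l i = ‖T i (b l)‖ ^ 2 := fun l => by
    rw [← real_inner_self_eq_norm_sq, ← hS_inner, hb, real_inner_smul_left,
      real_inner_self_eq_norm_sq, b.norm_eq_one]
    simp
  rw [← real_inner_self_eq_norm_sq, ← hS_inner, ← b.sum_inner_mul_inner]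
  refine Finset.sum_congr rfl fun l _ => ?_
  rw [hS_symm, hb, real_inner_smul_right, hα, real_inner_comm]
  ring

/-- The max-min/min-max equality for a convex family of operators whose quadratic forms are
simultaneously diagonalizable. -/
theorem iSup_iInf_norm_apply_eq_iInf_norm {F : Type*} [AddCommGroup F] [Module ℝ F]
    (Φ : F →ₗ[ℝ] E →L[ℝ] E)
    (hΦ : ∀ x y, Commute (star (Φ x) * Φ x) (star (Φ y) * Φ y))
    {P : Set F} (hP : Convex ℝ P) (hP_ne : P.Nonempty) :
    (⨆ v : {v : E // ‖v‖ = 1}, ⨅ p : P, ‖Φ p v.1‖) = ⨅ p : P, ‖Φ p‖ := by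
  have := hP_ne.to_subtype
  have hbdd : BddBelow (Set.range fun p : P => ‖Φ p‖) := ⟨0, by rintro _ ⟨p, rfl⟩; positivity⟩
  have hle : ∀ v : {v : E // ‖v‖ = 1}, ⨅ p : P, ‖Φ p v.1‖ ≤ ⨅ p : P, ‖Φ p‖ := fun v =>
    ciInf_mono ⟨0, by rintro _ ⟨p, rfl⟩; positivity⟩ fun p => (Φ p).unit_le_opNorm v.1 v.2.le
  have hm₀ : 0 ≤ ⨅ p : P, ‖Φ p‖ := Real.iInf_nonneg fun p => norm_nonneg _
  refine le_antisymm (Real.iSup_le hle hm₀) ?_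
  cases subsingleton_or_nontrivial E with
  | inl hE =>
    have : IsEmpty {v : E // ‖v‖ = 1} := ⟨fun v => by
      have := v.2
      rw [Subsingleton.elim v.1 0, norm_zero] at this
      exact zero_ne_one this⟩
    have hΦ₀ : ∀ p : P, Φ p = 0 := fun p => by ext v; exact Subsingleton.elim _ _
    simp [hΦ₀]
  | inr hE =>
    have : Nonempty (Fin (Module.finrank ℝ E)) := ⟨⟨0, Module.finrank_pos⟩⟩
    obtain ⟨b, hb⟩ := exists_orthonormalBasis_norm_apply_sq_eq_sum Φ hΦ
    set m := ⨅ p : P, ‖Φ p‖ with hm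
    have hmax : ∀ p ∈ P, ∃ l, m ^ 2 ≤ ‖Φ p (b l)‖ ^ 2 := fun p hp => by
      obtain ⟨l, hl⟩ := Finite.exists_max fun l => ‖Φ p (b l)‖
      refine ⟨l, pow_le_pow_left₀ hm₀ ((ciInf_le hbdd ⟨p, hp⟩).trans ?_) 2⟩
      refine (Φ p).opNorm_le_bound (norm_nonneg _) fun v => ?_
      refine le_of_sq_le_sq ?_ (by positivity)
      rw [hb, mul_pow, ← b.sum_sq_inner_right v, Finset.mul_sum]
      refine Finset.sum_le_sum fun j _ => ?_
      rw [mul_comm]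
      gcongr
      exact hl j
    have hconv : ∀ l, ConvexOn ℝ P fun p => ‖Φ p (b l)‖ ^ 2 := fun l =>
      (((convexOn_norm convex_univ).comp_linearMap
        ((ContinuousLinearMap.apply ℝ E (b l)).toLinearMap ∘ₗ Φ)).subset
          (Set.subset_univ _) hP).pow (fun _ _ => norm_nonneg _) 2
    obtain ⟨w, ⟨hw_nonneg, hw_sum⟩, hw⟩ := exists_mem_stdSimplex_forall_le_sum_s5 hP_ne hconv hmax
    set v : E := ∑ l, √(w l) • b l with hv
    have hv_inner : ∀ l, ⟪b l, v⟫ ^ 2 = w l := fun l => by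
      rw [hv, b.orthonormal.inner_right_fintype, Real.sq_sqrt (hw_nonneg l)]
    have hv_norm : ‖v‖ = 1 := by
      rw [← sq_eq_sq₀ (norm_nonneg _) zero_le_one, ← b.sum_sq_inner_right v]
      simp [hv_inner, hw_sum]
    refine le_ciSup_of_le ⟨m, by rintro _ ⟨v, rfl⟩; exact hle v⟩ ⟨v, hv_norm⟩ ?_
    refine le_ciInf fun p => le_of_sq_le_sq ?_ (norm_nonneg _)
    rw [hb]
    simpa only [hv_inner] using hw p p.2

end InnerProductSpace

/-- The elements `star (p a) * p a`, for polynomials `p` and a normal element `a`, commute. -/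
theorem commute_star_mul_self_aeval {R : Type*} [Ring R] [StarRing R] [Algebra ℝ R]
    [StarModule ℝ R] {a : R} (ha : Commute (star a) a) (p q : ℝ[X]) :
    Commute (star (aeval a p) * aeval a p) (star (aeval a q) * aeval a q) := by
  have hcomm : ∀ (x : R) (r : ℝ[X]), Commute x a → Commute x (aeval a r) := fun x r hx =>
    r.induction_on' (fun p q hp hq => by simpa using hp.add_right hq) fun n c => by
      rw [aeval_monomial]
      exact (Algebra.commute_algebraMap_right c x).mul_right (hx.pow_right n)
  have hpq : ∀ r s : ℝ[X], Commute (aeval a r) (aeval a s) := fun r s => by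
    simp only [Commute, SemiconjBy, ← map_mul, mul_comm]
  have hstar : ∀ r s : ℝ[X], Commute (star (aeval a r)) (aeval a s) := fun r s =>
    hcomm _ s (by simpa using (commute_star_star.2 (hcomm (star a) r ha)).symm)
  exact ((commute_star_star.2 (hpq p q)).mul_right (hstar p q)).mul_left
    ((hstar q p).symm.mul_right (hpq p q))

/-- The worst-case GMRES case of the max-min/min-max equality for a normal real
matrix: polynomials of degree at most `k` with value `1` at the origin. -/
theorem maxmin_eq_minmax_gmres_normal_real
    (n k : ℕ) (hk : 1 ≤ k)
    (A : Matrix (Fin n) (Fin n) ℝ) (hA : Aᵀ * A = A * Aᵀ) :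
    (⨆ v : {v : EuclideanSpace ℝ (Fin n) // ‖v‖ = 1},
      ⨅ p : {p : Polynomial ℝ // p.natDegree ≤ k ∧ p.eval 0 = 1},
        ‖Matrix.toEuclideanCLM (𝕜 := ℝ) (aeval A p.1) v.1‖)
    = ⨅ p : {p : Polynomial ℝ // p.natDegree ≤ k ∧ p.eval 0 = 1},
        ‖Matrix.toEuclideanCLM (𝕜 := ℝ) (aeval A p.1)‖ := by
  set P : Set ℝ[X] := {p | p.natDegree ≤ k ∧ p.eval 0 = 1} with hP
  have hP_convex : Convex ℝ P := by
    rintro p ⟨hp, hp₀⟩ q ⟨hq, hq₀⟩ a b - - hab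
    refine ⟨natDegree_add_le_of_degree_le ((natDegree_smul_le a p).trans hp)
      ((natDegree_smul_le b q).trans hq), ?_⟩
    simp [hp₀, hq₀, hab]
  have hP_ne : P.Nonempty := ⟨1, by simp [hP]⟩
  refine iSup_iInf_norm_apply_eq_iInf_norm
    (LinearMapClass.linearMap (Matrix.toEuclideanCLM (n := Fin n) (𝕜 := ℝ)) ∘ₗ
      (aeval A).toLinearMap) (fun p q => ?_) hP_convex hP_ne
  have hA' : Commute (star A) A := by
    simpa [Commute, SemiconjBy, star_eq_conjTranspose, conjTranspose_eq_transpose_of_trivial]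
      using hA
  have := (commute_star_mul_self_aeval hA' p q).map (Matrix.toEuclideanCLM (n := Fin n) (𝕜 := ℝ))
  rw [map_mul, map_mul, map_star, map_star] at this
  exact this
end
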